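/- Let 1 ≤ k ≤ n and let f : Λ^k → ℝ. Then f is ext. one affine if and only if there exist a natural number m ≤ n and elements a_r ∈ Λ^{kr} for r = 0,…,m such that f(ω) = Σ_{r=0}^{m} ⟨a_r; ω^r⟩ for all ω ∈ Λ^k, where ω^r denotes the r-fold exterior power ω∧⋯∧ω (and ω^0 = 1, so ⟨a_0; ω^0⟩ = a_0 ∈ ℝ). Moreover, since ω^r = 0 for r > ⌊n/k⌋, one may take m ≤ ⌊n/k⌋. -/

import Mathlib

/-! Basic setup: `Λᵏ(ℝⁿ)` in coordinates with respect to the standard basis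
`e^I`, `I` a strictly increasing multi-index (modeled as a `k`-element subset of
`Fin n`), together with the exterior product, interior product, inner product,
Hodge star, and the various notions of one-directional convexity/affinity. -/

/-- Increasing multi-indices of length `k` in `{1,…,n}`: `k`-element subsets of `Fin n`.
`Idx n k` plays the role of `T_k`. -/
abbrev Idx (n k : ℕ) := {s : Finset (Fin n) // s.card = k}

/-- `Λᵏ(ℝⁿ)`, identified with its coordinates in the standard basis `e^I`. -/
abbrev Lam (n k : ℕ) := Idx n k → ℝ

/-- The sign `sgn(R,S)` defined by `e^{[R,S]} = sgn(R,S) e^R ∧ e^S` for disjoint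
increasing multi-indices: `(-1)` to the number of inversions between `R` and `S`. -/
def msign {n : ℕ} (R S : Finset (Fin n)) : ℝ :=
  (-1 : ℝ) ^ (((R ×ˢ S).filter (fun p => p.2 < p.1)).card)

/-- The basis form `e^S` (of degree `k = S.card`; zero if `k ≠ S.card`). -/
def bform {n k : ℕ} (S : Finset (Fin n)) : Lam n k :=
  fun I => if I.1 = S then 1 else 0

/-- Exterior (wedge) product in coordinates.  When `m = k + l` this is the wedge
product `Λᵏ × Λˡ → Λ^{k+l}`; for other `m` it is `0`. -/
def wedge {n k l m : ℕ} (ω : Lam n k) (φ : Lam n l) : Lam n m :=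
  fun I => ∑ R : Idx n k, ∑ S : Idx n l,
    if R.1 ∪ S.1 = I.1 ∧ Disjoint R.1 S.1 then msign R.1 S.1 * (ω R * φ S) else 0

/-- Interior product `a ⌟ b`, characterized by `⟨a ⌟ b; c⟩ = ⟨b; a ∧ c⟩`.  When
`m = k - j` this is the interior product `Λʲ × Λᵏ → Λ^{k-j}`; for other `m` it is `0`. -/
def iprod {n j k m : ℕ} (a : Lam n j) (b : Lam n k) : Lam n m :=
  fun C => ∑ A : Idx n j, ∑ B : Idx n k,
    if A.1 ∪ C.1 = B.1 ∧ Disjoint A.1 C.1 then msign A.1 C.1 * (a A * b B) else 0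

/-- Hodge star with respect to the standard orientation; when `m = n - k` this is
`∗ : Λᵏ → Λ^{n-k}`. -/
def hstar {n k m : ℕ} (ω : Lam n k) : Lam n m :=
  fun J => ∑ I : Idx n k, if I.1 = (J.1)ᶜ then msign I.1 J.1 * ω I else 0

/-- Inner product `⟨·;·⟩` on `Λᵏ` (the basis `e^I` is orthonormal). -/
def ip {n k : ℕ} (ω α : Lam n k) : ℝ := ∑ I : Idx n k, ω I * α I

/-- `s`-fold exterior power `ω^s = ω ∧ ⋯ ∧ ω` (with `ω^0 = 1 ∈ Λ⁰`). -/
def lpow {n k : ℕ} (ω : Lam n k) : (s : ℕ) → Lam n (k * s)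
  | 0 => bform ∅
  | s + 1 => wedge ω (lpow ω s)

/-- `f : Λᵏ → ℝ` is ext. one convex. -/
def ExtOneConvex {n k : ℕ} (f : Lam n k → ℝ) : Prop :=
  ∀ (ω : Lam n k) (a : Lam n 1) (b : Lam n (k-1)),
    ConvexOn ℝ Set.univ (fun t : ℝ => f (ω + t • (wedge a b : Lam n k)))

/-- `f : Λᵏ → ℝ` is ext. one affine. -/
def ExtOneAffine {n k : ℕ} (f : Lam n k → ℝ) : Prop :=
  ExtOneConvex f ∧ ExtOneConvex (fun ω => -f ω)

/-- `f : Λᵏ → ℝ` is int. one convex. -/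
def IntOneConvex {n k : ℕ} (f : Lam n k → ℝ) : Prop :=
  ∀ (ω : Lam n k) (a : Lam n 1) (b : Lam n (k+1)),
    ConvexOn ℝ Set.univ (fun t : ℝ => f (ω + t • (iprod a b : Lam n k)))

/-- `f : Λᵏ → ℝ` is int. one affine. -/
def IntOneAffine {n k : ℕ} (f : Lam n k → ℝ) : Prop :=
  IntOneConvex f ∧ IntOneConvex (fun ω => -f ω)

/-- `f : Λ^{k+1} × Λ^{k-1} → ℝ` is ext-int. one convex. -/
def ExtIntOneConvex {n k : ℕ} (f : Lam n (k+1) → Lam n (k-1) → ℝ) : Prop :=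
  ∀ (ξ : Lam n (k+1)) (η : Lam n (k-1)) (a : Lam n 1) (b : Lam n k),
    ConvexOn ℝ Set.univ
      (fun t : ℝ => f (ξ + t • (wedge a b : Lam n (k+1))) (η + t • (iprod a b : Lam n (k-1))))

/-- `f : Λ^{k+1} × Λ^{k-1} → ℝ` is ext-int. one affine. -/
def ExtIntOneAffine {n k : ℕ} (f : Lam n (k+1) → Lam n (k-1) → ℝ) : Prop :=
  ExtIntOneConvex f ∧ ExtIntOneConvex (fun ξ η => -f ξ η)

/-- `g : Λᵏ → ℝ` is affine, i.e. a constant plus a linear functional. -/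
def AffineFn {n k : ℕ} (g : Lam n k → ℝ) : Prop :=
  ∃ (c : ℝ) (a : Lam n k), ∀ ω, g ω = c + ip a ω

/-- A function that is affine in the directions of `D` factors as a linear form after an
exponential map `s` into a commutative algebra, with `s - 1` homogeneous on `D`. -/
theorem exists_commRing_realization {X : Type} [AddCommGroup X] [Module ℝ X] (f : X → ℝ)
    (D : Set X) (hf : ∀ x, ∀ d ∈ D, ∀ t : ℝ, f (x + t • d) = f x + t * (f (x + d) - f x)) :
    ∃ (Q : Type) (_ : CommRing Q) (_ : Algebra ℝ Q) (s : X → Q) (φ : Q →ₗ[ℝ] ℝ),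
      s 0 = 1 ∧ (∀ x y, s (x + y) = s x * s y) ∧ (∀ x, φ (s x) = f x) ∧
      ∀ d ∈ D, ∀ t : ℝ, s (t • d) - 1 = t • (s d - 1) := by
  let e : X → AddMonoidAlgebra ℝ X := fun x => AddMonoidAlgebra.single x 1
  have he : ∀ x y, e (x + y) = e x * e y := fun x y => by
    simp [e, AddMonoidAlgebra.single_mul_single]
  have he0 : e 0 = 1 := rfl
  obtain ⟨ψ, hψ⟩ : ∃ ψ : AddMonoidAlgebra ℝ X →ₗ[ℝ] ℝ, ∀ x, ψ (e x) = f x :=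
    ⟨(Finsupp.linearCombination ℝ f).comp (AddMonoidAlgebra.coeffLinearEquiv ℝ).toLinearMap,
      fun x => by
      simp [e]⟩
  have hind : ∀ (g : AddMonoidAlgebra ℝ X →ₗ[ℝ] ℝ), (∀ x, g (e x) = 0) → ∀ y, g y = 0 := by
    intro g hg y
    induction y using AddMonoidAlgebra.induction_linear with
    | zero => simp
    | add a b ha hb => simp [ha, hb]
    | single x c =>
      have : (AddMonoidAlgebra.single x c : AddMonoidAlgebra ℝ X) = c • e x := by simp [e]
      rw [this, map_smul, hg, smul_zero]
  let I : Ideal (AddMonoidAlgebra ℝ X) :=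
    { carrier := {x | ∀ y, ψ (y * x) = 0}
      add_mem' := fun {a b} ha hb y => by rw [mul_add, map_add, ha, hb, add_zero]
      zero_mem' := fun y => by simp
      smul_mem' := fun c x hx y => by rw [smul_eq_mul, ← mul_assoc]; exact hx _ }
  refine ⟨AddMonoidAlgebra ℝ X ⧸ I, inferInstance, inferInstance, fun x => Ideal.Quotient.mk I (e x),
    (I.restrictScalars ℝ).liftQ ψ fun x hx => by simpa using hx 1, ?_, ?_, ?_, ?_⟩
  · simp [he0]
  · intro x y; simp [he]
  · intro x; exact hψ x
  · intro d hd t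
    have : t • ((Ideal.Quotient.mk I) (e d) - 1) = Ideal.Quotient.mk I (t • (e d - 1)) := rfl
    rw [this, ← map_one (Ideal.Quotient.mk I), ← map_sub, Ideal.Quotient.eq]
    intro y
    refine hind (ψ.comp (LinearMap.mulRight ℝ (e (t • d) - 1 - t • (e d - 1)))) (fun x => ?_) y
    simp only [LinearMap.comp_apply, LinearMap.mulRight_apply, mul_sub, mul_smul_comm, mul_one,
      ← he, map_sub, map_smul, hψ, smul_eq_mul, hf x d hd t]
    ring

section
variable {V : Type} [AddCommGroup V] [Module ℝ V]

/-- The exterior product of a vector and a `k`-vector. -/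
def vecWedge (k : ℕ) (x : V) (y : ⋀[ℝ]^k V) : ⋀[ℝ]^(k + 1) V :=
  ⟨ExteriorAlgebra.ι ℝ x * y, by
    rw [ExteriorAlgebra.exteriorPower, pow_succ']
    exact Submodule.mul_mem_mul ⟨x, rfl⟩ y.2⟩

@[simp]
theorem coe_vecWedge (k : ℕ) (x : V) (y : ⋀[ℝ]^k V) :
    (vecWedge k x y : ExteriorAlgebra ℝ V) = ExteriorAlgebra.ι ℝ x * y := rfl

theorem vecWedge_add_left (k : ℕ) (x x' : V) (y : ⋀[ℝ]^k V) :
    vecWedge k (x + x') y = vecWedge k x y + vecWedge k x' y :=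
  Subtype.ext (by simp [add_mul])

theorem vecWedge_add_right (k : ℕ) (x : V) (y y' : ⋀[ℝ]^k V) :
    vecWedge k x (y + y') = vecWedge k x y + vecWedge k x y' :=
  Subtype.ext (by simp [mul_add])

theorem vecWedge_smul_left (k : ℕ) (c : ℝ) (x : V) (y : ⋀[ℝ]^k V) :
    vecWedge k (c • x) y = c • vecWedge k x y :=
  Subtype.ext (by simp)

theorem exists_ιMulti_update_eq_vecWedge (k : ℕ) (u : Fin (k + 1) → V) (j : Fin (k + 1)) :
    ∃ y : ⋀[ℝ]^k V, ∀ x : V,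
      exteriorPower.ιMulti ℝ (k + 1) (Function.update u j x) = vecWedge k x y := by
  have h0 : ∀ w : Fin (k + 1) → V, exteriorPower.ιMulti ℝ (k + 1) w =
      vecWedge k (w 0) (exteriorPower.ιMulti ℝ k (Matrix.vecTail w)) := fun w =>
    Subtype.ext (by simp [exteriorPower.ιMulti_apply_coe])
  by_cases hj : j = 0
  · subst hj
    refine ⟨exteriorPower.ιMulti ℝ k (Matrix.vecTail u), fun x => ?_⟩
    rw [h0]
    congr 2
    simp
  · refine ⟨-exteriorPower.ιMulti ℝ k (Matrix.vecTail (u ∘ Equiv.swap 0 j)), fun x => ?_⟩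
    have h1 := (exteriorPower.ιMulti ℝ (k + 1) (M := V)).map_swap (Function.update u j x)
      (Ne.symm hj)
    rw [← neg_eq_iff_eq_neg] at h1
    rw [← h1, h0]
    have h2 : Matrix.vecTail (Function.update u j x ∘ Equiv.swap 0 j) =
        Matrix.vecTail (u ∘ Equiv.swap 0 j) := by
      ext i
      simp only [Matrix.vecTail, Function.comp_apply]
      rw [Function.update_of_ne]
      intro h
      rw [Equiv.swap_apply_eq_iff, Equiv.swap_apply_right] at h
      exact Fin.succ_ne_zero i h
    rw [h2]
    apply Subtype.ext
    simp


theorem sub_one_mul_sub_one_eq_zero {X Q : Type} [AddCommGroup X] [Module ℝ X] [CommRing Q]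
    [Algebra ℝ Q] {s : X → Q} {D : Set X} (hs : ∀ x y, s (x + y) = s x * s y)
    (hD : ∀ d ∈ D, ∀ t : ℝ, s (t • d) - 1 = t • (s d - 1))
    {d d' : X} (hd : d ∈ D) (hd' : d' ∈ D) (hdd : d + d' ∈ D) :
    (s d - 1) * (s d' - 1) = 0 := by
  have sq : ∀ c ∈ D, (s c - 1) * (s c - 1) = 0 := by
    intro c hc
    have := hD c hc 2
    rw [two_smul ℝ c, hs, two_smul] at this
    linear_combination this
  have h1 := sq d hd
  have h2 := sq d' hd'
  have h3 := sq _ hdd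
  rw [hs] at h3
  have h4 : (2 : ℝ) • ((s d - 1) * (s d' - 1)) = 0 := by
    rw [two_smul]
    linear_combination h3 - (2 * s d' - 1) * h1 - (s d ^ 2) * h2
  exact (smul_eq_zero_iff_right two_ne_zero).1 h4

theorem add_sub_one {X Q : Type} [AddCommGroup X] [Module ℝ X] [CommRing Q]
    [Algebra ℝ Q] {s : X → Q} {D : Set X} (hs : ∀ x y, s (x + y) = s x * s y)
    (hD : ∀ d ∈ D, ∀ t : ℝ, s (t • d) - 1 = t • (s d - 1))
    {d d' : X} (hd : d ∈ D) (hd' : d' ∈ D) (hdd : d + d' ∈ D) :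
    s (d + d') - 1 = (s d - 1) + (s d' - 1) := by
  rw [hs]
  linear_combination sub_one_mul_sub_one_eq_zero hs hD hd hd' hdd

section
variable {Q : Type} [CommRing Q] [Algebra ℝ Q] {k : ℕ}

/-- The alternating map `v ↦ s (v₀ ∧ ⋯ ∧ v_k) - 1`. -/
def subOneAlternating (s : ⋀[ℝ]^(k + 1) V → Q) (hs0 : s 0 = 1)
    (hs : ∀ x y, s (x + y) = s x * s y)
    (hD : ∀ x y, ∀ t : ℝ, s (t • vecWedge k x y) - 1 = t • (s (vecWedge k x y) - 1)) :
    V [⋀^Fin (k + 1)]→ₗ[ℝ] Q where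
  toFun v := s (exteriorPower.ιMulti ℝ (k + 1) v) - 1
  map_update_add' {inst} u j x x' := by
    obtain rfl := Subsingleton.elim inst (instDecidableEqFin _)
    obtain ⟨y, hy⟩ := exists_ιMulti_update_eq_vecWedge k u j
    rw [hy, hy, hy, vecWedge_add_left]
    refine add_sub_one (D := {d | ∃ x y, d = vecWedge k x y}) hs ?_ ⟨_, _, rfl⟩ ⟨_, _, rfl⟩
      ⟨_, _, (vecWedge_add_left k x x' y).symm⟩
    rintro d ⟨x, y, rfl⟩
    exact hD x y
  map_update_smul' {inst} u j c x := by
    obtain rfl := Subsingleton.elim inst (instDecidableEqFin _)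
    obtain ⟨y, hy⟩ := exists_ιMulti_update_eq_vecWedge k u j
    rw [hy, hy, vecWedge_smul_left, hD]
  map_eq_zero_of_eq' v i j hij hne := by
    rw [(exteriorPower.ιMulti ℝ (k + 1)).map_eq_zero_of_eq v hij hne, hs0, sub_self]

theorem subOneAlternating_mul_eq_zero (s : ⋀[ℝ]^(k + 1) V → Q) (hs0 : s 0 = 1)
    (hs : ∀ x y, s (x + y) = s x * s y)
    (hD : ∀ x y, ∀ t : ℝ, s (t • vecWedge k x y) - 1 = t • (s (vecWedge k x y) - 1))
    (v w : Fin (k + 1) → V) (i j : Fin (k + 1)) (hvw : v i = w j) :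
    subOneAlternating s hs0 hs hD v * subOneAlternating s hs0 hs hD w = 0 := by
  obtain ⟨y, hy⟩ := exists_ιMulti_update_eq_vecWedge k v i
  obtain ⟨z, hz⟩ := exists_ιMulti_update_eq_vecWedge k w j
  have h1 := hy (v i)
  have h2 := hz (w j)
  rw [Function.update_eq_self] at h1 h2
  change (s _ - 1) * (s _ - 1) = 0
  rw [h1, h2, hvw]
  refine sub_one_mul_sub_one_eq_zero (D := {d | ∃ x y, d = vecWedge k x y}) hs ?_ ⟨_, _, rfl⟩
    ⟨_, _, rfl⟩ ⟨_, _, (vecWedge_add_right k _ y z).symm⟩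
  rintro d ⟨x, y, rfl⟩
  exact hD x y

/-- The alternating map `(v₁, …, v_r) ↦ A v₁ ⋯ A v_r`, for an alternating map `A` whose values
on tuples with a common vector multiply to zero. -/
def prodAlternating (A : V [⋀^Fin k]→ₗ[ℝ] Q)
    (hA : ∀ v w i j, v i = w j → A v * A w = 0) (r : ℕ) : V [⋀^Fin (r * k)]→ₗ[ℝ] Q where
  toFun v := ∏ i : Fin r, A fun j => v (finProdFinEquiv (i, j))
  map_update_add' {inst} v p x x' := by
    obtain rfl := Subsingleton.elim inst (instDecidableEqFin _)
    obtain ⟨⟨i, j⟩, rfl⟩ := finProdFinEquiv.surjective p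
    have h1 : ∀ x, (fun j' => Function.update v (finProdFinEquiv (i, j)) x
        (finProdFinEquiv (i, j'))) =
        Function.update (fun j' => v (finProdFinEquiv (i, j'))) j x := by
      intro x; ext j'; simp [Function.update_apply]
    have h2 : ∀ x, ∀ i' ∈ Finset.univ \ {i},
        A (fun j' => Function.update v (finProdFinEquiv (i, j)) x (finProdFinEquiv (i', j'))) =
          A fun j' => v (finProdFinEquiv (i', j')) := by
      intro x i' hi'
      congr 1; ext j'
      rw [Function.update_of_ne]
      simpa using fun h _ => absurd h (by simpa using hi')
    simp only [Finset.prod_eq_mul_prod_sdiff_singleton_of_mem (Finset.mem_univ i), h1,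
      Finset.prod_congr rfl (h2 _)]
    rw [A.map_update_add, add_mul]
  map_update_smul' {inst} v p c x := by
    obtain rfl := Subsingleton.elim inst (instDecidableEqFin _)
    obtain ⟨⟨i, j⟩, rfl⟩ := finProdFinEquiv.surjective p
    have h1 : ∀ x, (fun j' => Function.update v (finProdFinEquiv (i, j)) x
        (finProdFinEquiv (i, j'))) =
        Function.update (fun j' => v (finProdFinEquiv (i, j'))) j x := by
      intro x; ext j'; simp [Function.update_apply]
    have h2 : ∀ x, ∀ i' ∈ Finset.univ \ {i},
        A (fun j' => Function.update v (finProdFinEquiv (i, j)) x (finProdFinEquiv (i', j'))) =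
          A fun j' => v (finProdFinEquiv (i', j')) := by
      intro x i' hi'
      congr 1; ext j'
      rw [Function.update_of_ne]
      simpa using fun h _ => absurd h (by simpa using hi')
    simp only [Finset.prod_eq_mul_prod_sdiff_singleton_of_mem (Finset.mem_univ i), h1,
      Finset.prod_congr rfl (h2 _)]
    rw [A.map_update_smul, smul_mul_assoc]
  map_eq_zero_of_eq' v p q hpq hne := by
    obtain ⟨⟨i, j⟩, rfl⟩ := finProdFinEquiv.surjective p
    obtain ⟨⟨i', j'⟩, rfl⟩ := finProdFinEquiv.surjective q
    by_cases hi : i = i'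
    · subst hi
      exact Finset.prod_eq_zero (Finset.mem_univ i) (A.map_eq_zero_of_eq _ hpq
        fun h => hne (by rw [h]))
    · rw [← Finset.mul_prod_erase _ _ (Finset.mem_univ i),
        ← Finset.mul_prod_erase _ _ (Finset.mem_erase.2 ⟨Ne.symm hi, Finset.mem_univ i'⟩),
        ← mul_assoc, hA _ _ j j' hpq, zero_mul]

theorem exists_linearMap_pow (A : V [⋀^Fin k]→ₗ[ℝ] Q)
    (hA : ∀ v w i j, v i = w j → A v * A w = 0) (r : ℕ) :
    ∃ L : ExteriorAlgebra ℝ V →ₗ[ℝ] Q, ∀ x : ⋀[ℝ]^k V,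
      L ((x : ExteriorAlgebra ℝ V) ^ r) = exteriorPower.alternatingMapLinearEquiv A x ^ r := by
  let d := exteriorPower.alternatingMapLinearEquiv A
  let L : ExteriorAlgebra ℝ V →ₗ[ℝ] Q :=
    ExteriorAlgebra.liftAlternating (Pi.single (r * k) (prodAlternating A hA r))
  refine ⟨L, fun x => ?_⟩
  have key : L.compMultilinearMap ((MultilinearMap.mkPiAlgebraFin ℝ r
      (ExteriorAlgebra ℝ V)).compLinearMap fun _ => (⋀[ℝ]^k V).subtype) =
      (MultilinearMap.mkPiAlgebraFin ℝ r Q).compLinearMap fun _ => d := by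
    refine MultilinearMap.ext_of_span_eq_top (fun _ => exteriorPower.ιMulti_span ℝ k V) ?_
    intro v
    have h1 : (List.ofFn fun i => ExteriorAlgebra.ιMulti ℝ k (v i)).prod =
        ExteriorAlgebra.ιMulti ℝ (r * k)
          fun p => v (finProdFinEquiv.symm p).1 (finProdFinEquiv.symm p).2 := by
      have h2 : ∀ (i : Fin r) (j : Fin k) (h : (i : ℕ) * k + j < r * k),
          finProdFinEquiv.symm ⟨i * k + j, h⟩ = (i, j) := fun i j h => by
        rw [Equiv.symm_apply_eq]
        exact Fin.ext (by simp; ring)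
      simp only [ExteriorAlgebra.ιMulti_apply, List.ofFn_mul, List.prod_flatten, List.map_ofFn,
        Function.comp_def, h2]
    simp only [LinearMap.compMultilinearMap_apply, MultilinearMap.compLinearMap_apply,
      MultilinearMap.mkPiAlgebraFin_apply, Submodule.subtype_apply,
      exteriorPower.ιMulti_apply_coe, h1, L, ExteriorAlgebra.liftAlternating_apply_ιMulti,
      Pi.single_eq_same, d, exteriorPower.alternatingMapLinearEquiv_apply_ιMulti, List.prod_ofFn]
    change ∏ i : Fin r, A _ = _
    simp
  have := DFunLike.congr_fun key fun _ => x
  simpa using this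

theorem eq_exp_of_basis {X I : Type} [AddCommGroup X] [Module ℝ X] [Fintype I]
    (b : Module.Basis I ℝ X) [Module ℚ Q] {s : X → Q} (hs0 : s 0 = 1)
    (hs : ∀ x y, s (x + y) = s x * s y) (d : X →ₗ[ℝ] Q)
    (hd : ∀ i, ∀ t : ℝ, s (t • b i) = 1 + t • d (b i)) (hd2 : ∀ i, d (b i) * d (b i) = 0) (x : X) :
    s x = IsNilpotent.exp (d x) := by
  have hsq : ∀ i, ∀ t : ℝ, d (t • b i) ^ 2 = 0 := fun i t => by
    rw [map_smul, smul_pow, sq (d _), hd2, smul_zero]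
  have key : ∀ u : Finset I, IsNilpotent (d (∑ i ∈ u, b.repr x i • b i)) ∧
      s (∑ i ∈ u, b.repr x i • b i) = IsNilpotent.exp (d (∑ i ∈ u, b.repr x i • b i)) := by
    classical
    intro u
    induction u using Finset.induction_on with
    | empty => simp [hs0]
    | insert i u hi ih =>
      rw [Finset.sum_insert hi, map_add, hs, ih.2,
        IsNilpotent.exp_add_of_commute (Commute.all _ _) ⟨2, hsq i _⟩ ih.1]
      refine ⟨Commute.isNilpotent_add (Commute.all _ _) ⟨2, hsq i _⟩ ih.1, ?_⟩
      rw [hd, IsNilpotent.exp_eq_sum (hsq i _)]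
      simp [Finset.sum_range_succ]
  simpa [b.sum_repr] using (key Finset.univ).2
end

/-- A function on `⋀ᵏ⁺¹ V` that is affine in all directions `x ∧ y`, with `x` a vector, is a
polynomial in the exterior powers of its argument. -/
theorem exists_eq_sum_pow {I : Type} [LinearOrder I] [Fintype I] (b : Module.Basis I ℝ V) (k : ℕ)
    (f : ⋀[ℝ]^(k + 1) V → ℝ)
    (hf : ∀ ω x y, ∀ t : ℝ, f (ω + t • vecWedge k x y) =
      f ω + t * (f (ω + vecWedge k x y) - f ω)) :
    ∃ L : ℕ → ExteriorAlgebra ℝ V →ₗ[ℝ] ℝ, ∀ N : ℕ, ∀ ω : ⋀[ℝ]^(k + 1) V,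
      (ω : ExteriorAlgebra ℝ V) ^ N = 0 →
        f ω = ∑ r ∈ Finset.range N, L r ((ω : ExteriorAlgebra ℝ V) ^ r) := by
  obtain ⟨Q, _, _, s, φ, hs0, hs, hφ, hD⟩ := exists_commRing_realization f
    {d | ∃ x y, d = vecWedge k x y} (by rintro ω _ ⟨x, y, rfl⟩; exact hf ω x y)
  replace hD : ∀ x y, ∀ t : ℝ, s (t • vecWedge k x y) - 1 = t • (s (vecWedge k x y) - 1) :=
    fun x y => hD _ ⟨x, y, rfl⟩
  let A := subOneAlternating s hs0 hs hD
  have hA : ∀ v w i j, v i = w j → A v * A w = 0 := subOneAlternating_mul_eq_zero s hs0 hs hD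
  choose L hL using exists_linearMap_pow A hA
  let d := exteriorPower.alternatingMapLinearEquiv A
  let _ : Module ℚ Q := Module.compHom Q (algebraMap ℚ ℝ)
  have hsd : ∀ ω, s ω = IsNilpotent.exp (d ω) := by
    refine eq_exp_of_basis (b.exteriorPower (k + 1)) hs0 hs d (fun i t => ?_) fun i => ?_
    · rw [exteriorPower.basis_apply, exteriorPower.ιMulti_family]
      simp only [d, exteriorPower.alternatingMapLinearEquiv_apply_ιMulti]
      set w := b ∘ Set.powersetCard.ofFinEmbEquiv.symm i
      obtain ⟨y, hy⟩ := exists_ιMulti_update_eq_vecWedge k w 0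
      have := hD (w 0) y t
      rw [← hy, Function.update_eq_self] at this
      exact sub_eq_iff_eq_add'.1 this
    · rw [exteriorPower.basis_apply, exteriorPower.ιMulti_family]
      simp only [d, exteriorPower.alternatingMapLinearEquiv_apply_ιMulti]
      exact hA _ _ 0 0 rfl
  refine ⟨fun r => ((r.factorial : ℝ)⁻¹ • φ).comp (L r), fun N ω hω => ?_⟩
  have hdN : d ω ^ N = 0 := by rw [← hL, hω, map_zero]
  rw [← hφ, hsd, IsNilpotent.exp_eq_sum hdN, map_sum]
  refine Finset.sum_congr rfl fun r _ => ?_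
  have : ((r.factorial : ℚ)⁻¹ • d ω ^ r) = (r.factorial : ℝ)⁻¹ • d ω ^ r := by
    change (algebraMap ℚ ℝ (r.factorial : ℚ)⁻¹) • d ω ^ r = _
    simp
  rw [this, map_smul, ← hL]
  rfl

end

theorem msign_singleton_of_forall_lt {n : ℕ} {i : Fin n} {S : Finset (Fin n)}
    (h : ∀ j ∈ S, i < j) : msign {i} S = 1 := by
  rw [msign, Finset.card_eq_zero.2, pow_zero]
  ext p
  simp only [Finset.mem_filter, Finset.mem_product, Finset.mem_singleton, Finset.notMem_empty,
    iff_false, not_and, not_lt, and_imp]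
  intro hp hS
  exact hp ▸ (h _ hS).le

theorem msign_union_left {n : ℕ} {R R' S : Finset (Fin n)} (h : Disjoint R R') :
    msign (R ∪ R') S = msign R S * msign R' S := by
  rw [msign, msign, msign, ← pow_add, Finset.union_product, Finset.filter_union,
    Finset.card_union_of_disjoint]
  exact Finset.disjoint_filter_filter (Finset.disjoint_product.2 (Or.inl h))

theorem msign_union_right {n : ℕ} {R S S' : Finset (Fin n)} (h : Disjoint S S') :
    msign R (S ∪ S') = msign R S * msign R S' := by
  rw [msign, msign, msign, ← pow_add, Finset.product_union, Finset.filter_union,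
    Finset.card_union_of_disjoint]
  exact Finset.disjoint_filter_filter (Finset.disjoint_product.2 (Or.inr h))

theorem msign_empty_left {n : ℕ} (S : Finset (Fin n)) : msign ∅ S = 1 := by
  simp [msign]

theorem msign_singleton_singleton_of_lt {n : ℕ} {i j : Fin n} (h : j < i) :
    msign {i} {j} = -1 := by
  simp [msign, Finset.filter_singleton, h]

open ExteriorAlgebra in
/-- The exterior product of the standard basis vectors indexed by `S`, in increasing order. -/
noncomputable def extBasis {n : ℕ} (S : Finset (Fin n)) : ExteriorAlgebra ℝ (Fin n → ℝ) :=
  (S.sort.map fun i => ι ℝ (Pi.basisFun ℝ (Fin n) i)).prod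

section
open ExteriorAlgebra

variable {n : ℕ}

theorem extBasis_empty : extBasis (∅ : Finset (Fin n)) = 1 := by
  simp [extBasis]

theorem extBasis_insert {i : Fin n} {S : Finset (Fin n)} (h : ∀ j ∈ S, i < j) :
    extBasis (insert i S) = ι ℝ (Pi.basisFun ℝ (Fin n) i) * extBasis S := by
  rw [extBasis, Finset.sort_insert _ (fun j hj => (h j hj).le) (fun hi => (h i hi).false)]
  simp [extBasis]

theorem ι_mul_ι_mul_swap (x y : Fin n → ℝ) (z : ExteriorAlgebra ℝ (Fin n → ℝ)) :
    ι ℝ x * (ι ℝ y * z) = -(ι ℝ y * (ι ℝ x * z)) := by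
  rw [← mul_assoc, ← mul_assoc, eq_neg_iff_add_eq_zero, ← add_mul, ι_add_mul_swap, zero_mul]

theorem ι_mul_extBasis (i : Fin n) (S : Finset (Fin n)) :
    ι ℝ (Pi.basisFun ℝ (Fin n) i) * extBasis S =
      if i ∈ S then 0 else msign {i} S • extBasis (insert i S) := by
  induction S using Finset.induction_on_min with
  | empty =>
    rw [if_neg (Finset.notMem_empty i), extBasis_insert (by simp)]
    simp [msign]
  | insert j S hj ih =>
    rcases lt_trichotomy i j with hij | rfl | hij
    · have h : ∀ l ∈ insert j S, i < l := by
        simp only [Finset.mem_insert, forall_eq_or_imp]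
        exact ⟨hij, fun l hl => hij.trans (hj l hl)⟩
      rw [if_neg fun hi => (h i hi).false, msign_singleton_of_forall_lt h, one_smul,
        extBasis_insert h]
    · rw [if_pos (Finset.mem_insert_self _ _), extBasis_insert hj, ← mul_assoc, ι_sq_zero,
        zero_mul]
    · rw [extBasis_insert hj, ι_mul_ι_mul_swap, ih]
      by_cases hi : i ∈ S
      · simp [hi]
      · have hd : Disjoint {j} S := by
          simpa using fun h => (hj j h).false
        have h : ∀ l ∈ insert i S, j < l := by
          simp only [Finset.mem_insert, forall_eq_or_imp]
          exact ⟨hij, hj⟩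
        rw [if_neg hi, if_neg (by simp [hi, hij.ne']), Finset.insert_comm, extBasis_insert h,
          Finset.insert_eq j S, msign_union_right hd, msign_singleton_singleton_of_lt hij,
          mul_smul_comm, neg_one_mul, neg_smul]

theorem extBasis_mul (R S : Finset (Fin n)) :
    extBasis R * extBasis S =
      if Disjoint R S then msign R S • extBasis (R ∪ S) else 0 := by
  induction R using Finset.induction_on_min with
  | empty => simp [extBasis_empty, msign_empty_left]
  | insert i R hi ih =>
    have hd : Disjoint {i} R := by
      simpa using fun h => (hi i h).false
    rw [extBasis_insert hi, mul_assoc, ih]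
    by_cases hRS : Disjoint R S
    · rw [if_pos hRS, mul_smul_comm, ι_mul_extBasis]
      by_cases hiS : i ∈ S
      · simp [hiS]
      · have hiR : i ∉ R := fun h => (hi i h).false
        rw [if_neg (by simp [hiR, hiS]), if_pos (by simp [hiS, hRS]), Finset.insert_eq i R,
          msign_union_left hd, msign_union_right hRS, msign_singleton_of_forall_lt hi, one_mul,
          smul_smul, mul_comm, ← Finset.insert_eq, Finset.insert_union]
    · rw [if_neg hRS, mul_zero, if_neg]
      simp [hRS]

theorem extBasis_mul_ι (S : Finset (Fin n)) (x : Fin n → ℝ) :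
    extBasis S * ι ℝ x = (-1 : ℝ) ^ S.card • (ι ℝ x * extBasis S) := by
  induction S using Finset.induction_on_min with
  | empty => simp [extBasis_empty]
  | insert i S hi ih =>
    rw [extBasis_insert hi, mul_assoc, ih, Finset.card_insert_of_notMem fun h => (hi i h).false,
      pow_succ, mul_smul_comm, ι_mul_ι_mul_swap, mul_neg_one, neg_smul, smul_neg]

variable (n) in
/-- The basis of `⋀ᵏ ℝⁿ` indexed by increasing multi-indices. -/
noncomputable def idxBasis (k : ℕ) : Module.Basis (Idx n k) ℝ (⋀[ℝ]^k (Fin n → ℝ)) :=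
  ((Pi.basisFun ℝ (Fin n)).exteriorPower k).reindex
    (Equiv.subtypeEquivRight fun _ => Set.powersetCard.mem_iff)

theorem coe_idxBasis (k : ℕ) (I : Idx n k) :
    (idxBasis n k I : ExteriorAlgebra ℝ (Fin n → ℝ)) = extBasis I.1 := by
  have h : (idxBasis n k I : ExteriorAlgebra ℝ (Fin n → ℝ)) =
      ExteriorAlgebra.ιMulti ℝ k (Pi.basisFun ℝ (Fin n) ∘ I.1.orderEmbOfFin I.2) := by
    rw [idxBasis, Module.Basis.reindex_apply, exteriorPower.basis_apply]
    rfl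
  obtain ⟨S, rfl⟩ := I
  rw [h, ιMulti_apply, extBasis]
  congr 1
  refine List.ext_getElem (by simp) fun i h1 h2 => ?_
  simp [Finset.orderEmbOfFin_apply]

/-- The identification of `Lam n k` with `⋀ᵏ ℝⁿ`. -/
noncomputable def lamEquiv (n k : ℕ) : Lam n k ≃ₗ[ℝ] ⋀[ℝ]^k (Fin n → ℝ) :=
  (idxBasis n k).equivFun.symm

theorem coe_lamEquiv {k : ℕ} (ω : Lam n k) :
    (lamEquiv n k ω : ExteriorAlgebra ℝ (Fin n → ℝ)) = ∑ I : Idx n k, ω I • extBasis I.1 := by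
  simp [lamEquiv, Module.Basis.equivFun_symm_apply, coe_idxBasis]

theorem coe_lamEquiv_wedge {k l m : ℕ} (hm : m = k + l) (ω : Lam n k) (φ : Lam n l) :
    (lamEquiv n m (wedge ω φ) : ExteriorAlgebra ℝ (Fin n → ℝ)) =
      lamEquiv n k ω * lamEquiv n l φ := by
  simp only [coe_lamEquiv, wedge, Finset.sum_smul, Finset.sum_mul_sum]
  rw [Finset.sum_comm]
  refine Finset.sum_congr rfl fun R _ => ?_
  rw [Finset.sum_comm]
  refine Finset.sum_congr rfl fun S _ => ?_
  rw [smul_mul_smul_comm, extBasis_mul]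
  by_cases hd : Disjoint R.1 S.1
  · have hc : (R.1 ∪ S.1).card = m := by
      rw [Finset.card_union_of_disjoint hd, R.2, S.2, hm]
    rw [Finset.sum_eq_single ⟨R.1 ∪ S.1, hc⟩]
    · rw [if_pos ⟨rfl, hd⟩, if_pos hd, smul_smul, mul_comm]
    · intro I _ hI
      rw [if_neg, zero_smul]
      exact fun h => hI (Subtype.ext h.1.symm)
    · simp
  · simp [hd]

theorem coe_lamEquiv_lpow {k : ℕ} (ω : Lam n k) (r : ℕ) :
    (lamEquiv n (k * r) (lpow ω r) : ExteriorAlgebra ℝ (Fin n → ℝ)) =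
      (lamEquiv n k ω : ExteriorAlgebra ℝ (Fin n → ℝ)) ^ r := by
  induction r with
  | zero =>
    rw [coe_lamEquiv, Finset.sum_eq_single ⟨∅, rfl⟩]
    · simp [lpow, bform, extBasis_empty]
    · intro I _ hI
      rw [lpow, bform, if_neg fun h => hI (Subtype.ext h), zero_smul]
    · simp
  | succ r ih =>
    rw [lpow, coe_lamEquiv_wedge (by ring), ih, pow_succ']

theorem coe_lamEquiv_mul_ι {k : ℕ} (ω : Lam n k) (x : Fin n → ℝ) :
    (lamEquiv n k ω : ExteriorAlgebra ℝ (Fin n → ℝ)) * ι ℝ x =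
      (-1 : ℝ) ^ k • (ι ℝ x * lamEquiv n k ω) := by
  simp only [coe_lamEquiv, Finset.sum_mul, Finset.mul_sum, Finset.smul_sum]
  refine Finset.sum_congr rfl fun I _ => ?_
  rw [smul_mul_assoc, extBasis_mul_ι, I.2, mul_smul_comm, smul_comm]

theorem exists_ι_eq_coe_lamEquiv (a : Lam n 1) :
    ∃ x : Fin n → ℝ, (lamEquiv n 1 a : ExteriorAlgebra ℝ (Fin n → ℝ)) = ι ℝ x := by
  have h : (lamEquiv n 1 a : ExteriorAlgebra ℝ (Fin n → ℝ)) ∈ LinearMap.range (ι ℝ) ^ 1 :=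
    (lamEquiv n 1 a).2
  rw [pow_one] at h
  obtain ⟨x, hx⟩ := h
  exact ⟨x, hx.symm⟩

theorem exists_coe_lamEquiv_eq_ι (x : Fin n → ℝ) :
    ∃ a : Lam n 1, (lamEquiv n 1 a : ExteriorAlgebra ℝ (Fin n → ℝ)) = ι ℝ x :=
  ⟨(lamEquiv n 1).symm ⟨ι ℝ x, by
    change _ ∈ LinearMap.range (ι ℝ) ^ 1
    rw [pow_one]
    exact ⟨x, rfl⟩⟩, by simp⟩

theorem exists_coe_lamEquiv_add_pow {k l : ℕ} (ω : Lam n k) (b : Lam n l) (x : Fin n → ℝ) (r : ℕ) :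
    ∃ X Y : ExteriorAlgebra ℝ (Fin n → ℝ), ∀ t : ℝ,
      (lamEquiv n k ω + t • (ι ℝ x * lamEquiv n l b) : ExteriorAlgebra ℝ (Fin n → ℝ)) ^ r =
        X + t • (ι ℝ x * Y) := by
  induction r with
  | zero => exact ⟨1, 0, by simp⟩
  | succ r ih =>
    obtain ⟨X, Y, h⟩ := ih
    refine ⟨lamEquiv n k ω * X, lamEquiv n l b * X + (-1 : ℝ) ^ k • (lamEquiv n k ω * Y),
      fun t => ?_⟩
    have h1 : (lamEquiv n k ω : ExteriorAlgebra ℝ (Fin n → ℝ)) * (ι ℝ x * Y) =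
        ι ℝ x * ((-1 : ℝ) ^ k • (lamEquiv n k ω * Y)) := by
      rw [← mul_assoc, coe_lamEquiv_mul_ι, smul_mul_assoc, mul_smul_comm, mul_assoc]
    have h2 : ι ℝ x * (lamEquiv n l b : ExteriorAlgebra ℝ (Fin n → ℝ)) * (ι ℝ x * Y) = 0 := by
      rw [mul_assoc, ← mul_assoc _ _ Y, coe_lamEquiv_mul_ι, smul_mul_assoc, mul_smul_comm,
        mul_assoc, ← mul_assoc, ι_sq_zero, zero_mul, smul_zero]
    rw [pow_succ', h, add_mul, mul_add, mul_add, mul_smul_comm, smul_mul_smul_comm, h2, h1,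
      smul_zero, smul_mul_assoc, mul_add, mul_assoc, smul_add]
    abel

theorem exists_linearMap_eq_ip {k : ℕ} (a : Lam n k) :
    ∃ L : ExteriorAlgebra ℝ (Fin n → ℝ) →ₗ[ℝ] ℝ, ∀ ω : Lam n k, L (lamEquiv n k ω) = ip a ω := by
  obtain ⟨L, hL⟩ := LinearMap.exists_extend
    ((Fintype.linearCombination ℝ a).comp (lamEquiv n k).symm.toLinearMap)
  refine ⟨L, fun ω => ?_⟩
  have := LinearMap.congr_fun hL (lamEquiv n k ω)
  simp only [LinearMap.comp_apply, Submodule.subtype_apply, LinearEquiv.coe_coe,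
    LinearEquiv.symm_apply_apply, Fintype.linearCombination_apply] at this
  rw [this, ip]
  exact Finset.sum_congr rfl fun I _ => mul_comm _ _

theorem exists_ip_eq_linearMap (k : ℕ) (L : ExteriorAlgebra ℝ (Fin n → ℝ) →ₗ[ℝ] ℝ) :
    ∃ a : Lam n k, ∀ ω : Lam n k, ip a ω = L (lamEquiv n k ω) := by
  refine ⟨fun I => L (extBasis I.1), fun ω => ?_⟩
  rw [coe_lamEquiv, map_sum, ip]
  exact Finset.sum_congr rfl fun I _ => by rw [map_smul, smul_eq_mul, mul_comm]

theorem coe_lamEquiv_pow_eq_zero {k : ℕ} (hk : 1 ≤ k) (ω : Lam n k) :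
    (lamEquiv n k ω : ExteriorAlgebra ℝ (Fin n → ℝ)) ^ (n / k + 1) = 0 := by
  rw [← coe_lamEquiv_lpow, coe_lamEquiv, Finset.sum_eq_zero]
  intro I _
  have h1 := I.1.card_le_univ
  rw [I.2, Fintype.card_fin] at h1
  exact absurd h1 (not_le.2 (Nat.lt_mul_div_succ n hk))

end

theorem affine_of_convexOn_of_convexOn_neg {h : ℝ → ℝ} (h1 : ConvexOn ℝ Set.univ h)
    (h2 : ConvexOn ℝ Set.univ fun t => -h t) (t : ℝ) : h t = h 0 + t * (h 1 - h 0) := by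
  have seg : ∀ x y a b : ℝ, 0 ≤ a → 0 ≤ b → a + b = 1 →
      h (a * x + b * y) = a * h x + b * h y := by
    intro x y a b ha hb hab
    have e1 := h1.2 (Set.mem_univ x) (Set.mem_univ y) ha hb hab
    have e2 := h2.2 (Set.mem_univ x) (Set.mem_univ y) ha hb hab
    simp only [smul_eq_mul] at e1 e2
    linarith
  rcases le_total t 0 with ht | ht
  · have ht' : (0 : ℝ) < 1 - t := by linarith
    have := seg t 1 (1 / (1 - t)) (-t / (1 - t)) (by positivity)
      (div_nonneg (by linarith) ht'.le) (by field_simp; ring)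
    rw [show 1 / (1 - t) * t + -t / (1 - t) * 1 = 0 by field_simp; ring] at this
    field_simp at this
    linarith
  · rcases le_total t 1 with ht1 | ht1
    · have := seg 0 1 (1 - t) t (by linarith) ht (by ring)
      rw [show (1 - t) * 0 + t * 1 = t by ring] at this
      linarith
    · have ht' : (0 : ℝ) < t := by linarith
      have := seg 0 t (1 - 1 / t) (1 / t) (by
        rw [sub_nonneg, div_le_one ht']; exact ht1) (by positivity) (by ring)
      rw [show (1 - 1 / t) * 0 + 1 / t * t = 1 by field_simp; ring] at this
      field_simp at this
      linarith

theorem ExtOneAffine.apply_add_smul_wedge {n k : ℕ} {f : Lam n k → ℝ} (hf : ExtOneAffine f)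
    (ω : Lam n k) (a : Lam n 1) (b : Lam n (k - 1)) (t : ℝ) :
    f (ω + t • (wedge a b : Lam n k)) = f ω + t * (f (ω + (wedge a b : Lam n k)) - f ω) := by
  simpa using affine_of_convexOn_of_convexOn_neg (hf.1 ω a b) (hf.2 ω a b) t

theorem extOneAffine_of_apply_add_smul_wedge {n k : ℕ} {f : Lam n k → ℝ}
    (hf : ∀ (ω : Lam n k) (a : Lam n 1) (b : Lam n (k - 1)), ∃ c d : ℝ, ∀ t : ℝ,
      f (ω + t • (wedge a b : Lam n k)) = c + t * d) : ExtOneAffine f := by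
  refine ⟨fun ω a b => ?_, fun ω a b => ?_⟩ <;> obtain ⟨c, d, h⟩ := hf ω a b <;>
    simp only [h] <;> refine ⟨convex_univ, fun x _ y _ p q _ _ hpq => le_of_eq ?_⟩ <;>
    simp only [smul_eq_mul] <;> obtain rfl := eq_sub_of_add_eq hpq <;> ring

/-- **Theorem (Characterization of ext. one affine functions).**
Let `1 ≤ k ≤ n` and `f : Λᵏ → ℝ`.  Then `f` is ext. one affine iff there exist `m ∈ ℕ`,
`m ≤ n`, and `a_r ∈ Λ^{kr}` (`r = 0,…,m`) with `f(ω) = ∑_{r=0}^m ⟨a_r; ω^r⟩` for all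
`ω ∈ Λᵏ`; moreover one may take `m ≤ ⌊n/k⌋`. -/
theorem stmt2 {n k : ℕ} (hk : 1 ≤ k) (hkn : k ≤ n) (f : Lam n k → ℝ) :
    ExtOneAffine f ↔
      ∃ (m : ℕ) (a : (r : ℕ) → Lam n (k * r)), m ≤ n ∧ m ≤ n / k ∧
        ∀ ω : Lam n k, f ω = ∑ r ∈ Finset.range (m+1), ip (a r) (lpow ω r) := by
  constructor
  · intro hf
    obtain ⟨k, rfl⟩ : ∃ l, k = l + 1 := ⟨k - 1, by omega⟩
    obtain ⟨L, hL⟩ := exists_eq_sum_pow (Pi.basisFun ℝ (Fin n)) k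
      (fun X => f ((lamEquiv n (k + 1)).symm X)) (by
        intro ω x y t
        obtain ⟨a, ha⟩ := exists_coe_lamEquiv_eq_ι x
        have hw : (lamEquiv n (k + 1)).symm (vecWedge k x y) =
            wedge a ((lamEquiv n k).symm y) := by
          rw [LinearEquiv.symm_apply_eq]
          apply Subtype.ext
          rw [coe_lamEquiv_wedge (by ring), ha, coe_vecWedge, LinearEquiv.apply_symm_apply]
        simp only [map_add, map_smul, hw]
        exact hf.apply_add_smul_wedge _ a ((lamEquiv n k).symm y) t)
    choose a ha using fun r => exists_ip_eq_linearMap ((k + 1) * r) (L r)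
    refine ⟨n / (k + 1), a, Nat.div_le_self _ _, le_rfl, fun ω => ?_⟩
    simpa [ha, coe_lamEquiv_lpow] using hL _ _ (coe_lamEquiv_pow_eq_zero hk ω)
  · rintro ⟨m, a, -, -, h⟩
    refine extOneAffine_of_apply_add_smul_wedge fun ω u b => ?_
    obtain ⟨x, hx⟩ := exists_ι_eq_coe_lamEquiv u
    choose L hL using fun r => exists_linearMap_eq_ip (a r)
    choose X Y hXY using exists_coe_lamEquiv_add_pow ω b x
    refine ⟨∑ r ∈ Finset.range (m + 1), L r (X r),
      ∑ r ∈ Finset.range (m + 1), L r (ExteriorAlgebra.ι ℝ x * Y r), fun t => ?_⟩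
    rw [h, Finset.mul_sum, ← Finset.sum_add_distrib]
    refine Finset.sum_congr rfl fun r _ => ?_
    rw [← hL, coe_lamEquiv_lpow, map_add, map_smul, Submodule.coe_add, Submodule.coe_smul,
      coe_lamEquiv_wedge (by omega), hx, hXY, map_add, map_smul, smul_eq_mul]
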